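/- Let τ: B⊗A → A⊗B be a graded twisting map with the unique extension property. If A and B are quadratic 𝕜-algebras, then the twisted tensor product A⊗_τB is a quadratic algebra. -/

import Mathlib

open TensorProduct

noncomputable section

namespace TTP

variable (𝕜 : Type) [Field 𝕜]

/-- The image of `p ⊗ q` inside `M ⊗[𝕜] N`, for submodules `p ⊆ M`, `q ⊆ N`. -/
def subTmul {M N : Type} [AddCommGroup M] [Module 𝕜 M] [AddCommGroup N] [Module 𝕜 N]
    (p : Submodule 𝕜 M) (q : Submodule 𝕜 N) : Submodule 𝕜 (M ⊗[𝕜] N) :=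
  LinearMap.range (TensorProduct.map p.subtype q.subtype)

/-- The Künneth grading on a tensor product of graded vector spaces. -/
def kunneth {M N : Type} [AddCommGroup M] [Module 𝕜 M] [AddCommGroup N] [Module 𝕜 N]
    (𝒜 : ℕ → Submodule 𝕜 M) (ℬ : ℕ → Submodule 𝕜 N) (n : ℕ) : Submodule 𝕜 (M ⊗[𝕜] N) :=
  ⨆ (pq : ℕ × ℕ) (_ : pq.1 + pq.2 = n), subTmul 𝕜 (𝒜 pq.1) (ℬ pq.2)

/-- The positive part `X₊ = ⊕_{i>0} X_i` of a graded vector space. -/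
def plusPart {M : Type} [AddCommGroup M] [Module 𝕜 M] (𝒜 : ℕ → Submodule 𝕜 M) :
    Submodule 𝕜 M :=
  ⨆ (i : ℕ) (_ : 0 < i), 𝒜 i

/-- The grading concentrating `𝒜 1` in degree `1` (and `⊥` elsewhere). -/
def degOne {M : Type} [AddCommGroup M] [Module 𝕜 M] (𝒜 : ℕ → Submodule 𝕜 M) :
    ℕ → Submodule 𝕜 M :=
  fun n => if n = 1 then 𝒜 1 else ⊥

variable (A B : Type) [Ring A] [Algebra 𝕜 A] [Ring B] [Algebra 𝕜 B]

/-- `τ ∘ (μ_B ⊗ μ_A)` on `(B ⊗ B) ⊗ (A ⊗ A)`. -/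
def twistLHS (τ : B ⊗[𝕜] A →ₗ[𝕜] A ⊗[𝕜] B) :
    (B ⊗[𝕜] B) ⊗[𝕜] (A ⊗[𝕜] A) →ₗ[𝕜] A ⊗[𝕜] B :=
  τ ∘ₗ TensorProduct.map (LinearMap.mul' 𝕜 B) (LinearMap.mul' 𝕜 A)

/-- `(μ_A ⊗ μ_B) ∘ (1_A ⊗ τ ⊗ 1_B) ∘ (τ ⊗ τ) ∘ (1_B ⊗ τ ⊗ 1_A)` on `(B ⊗ B) ⊗ (A ⊗ A)`. -/
def twistRHS (τ : B ⊗[𝕜] A →ₗ[𝕜] A ⊗[𝕜] B) :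
    (B ⊗[𝕜] B) ⊗[𝕜] (A ⊗[𝕜] A) →ₗ[𝕜] A ⊗[𝕜] B :=
  TensorProduct.map (LinearMap.mul' 𝕜 A) (LinearMap.mul' 𝕜 B)
    ∘ₗ (TensorProduct.assoc 𝕜 A A (B ⊗[𝕜] B)).symm.toLinearMap
    ∘ₗ LinearMap.lTensor A (TensorProduct.assoc 𝕜 A B B).toLinearMap
    ∘ₗ LinearMap.lTensor A (LinearMap.rTensor B τ)
    ∘ₗ LinearMap.lTensor A (TensorProduct.assoc 𝕜 B A B).symm.toLinearMap
    ∘ₗ (TensorProduct.assoc 𝕜 A B (A ⊗[𝕜] B)).toLinearMap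
    ∘ₗ TensorProduct.map τ τ
    ∘ₗ (TensorProduct.assoc 𝕜 B A (B ⊗[𝕜] A)).symm.toLinearMap
    ∘ₗ LinearMap.lTensor B (TensorProduct.assoc 𝕜 A B A).toLinearMap
    ∘ₗ LinearMap.lTensor B (LinearMap.rTensor A τ)
    ∘ₗ LinearMap.lTensor B (TensorProduct.assoc 𝕜 B A A).symm.toLinearMap
    ∘ₗ (TensorProduct.assoc 𝕜 B B (A ⊗[𝕜] A)).toLinearMap

/-- `τ : B ⊗ A → A ⊗ B` is an (algebra) twisting map: it satisfies the unital twisting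
conditions and `τ(μ_B ⊗ μ_A) = (μ_A ⊗ μ_B)(1_A ⊗ τ ⊗ 1_B)(τ ⊗ τ)(1_B ⊗ τ ⊗ 1_A)`. -/
def IsTwisting (τ : B ⊗[𝕜] A →ₗ[𝕜] A ⊗[𝕜] B) : Prop :=
  (∀ a : A, τ ((1 : B) ⊗ₜ[𝕜] a) = a ⊗ₜ[𝕜] (1 : B)) ∧
  (∀ b : B, τ (b ⊗ₜ[𝕜] (1 : A)) = (1 : A) ⊗ₜ[𝕜] b) ∧
  twistLHS 𝕜 A B τ = twistRHS 𝕜 A B τ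

/-- `τ` preserves the Künneth grading. -/
def IsGradedMapBA (𝒜 : ℕ → Submodule 𝕜 A) (ℬ : ℕ → Submodule 𝕜 B)
    (τ : B ⊗[𝕜] A →ₗ[𝕜] A ⊗[𝕜] B) : Prop :=
  ∀ n, Submodule.map τ (kunneth 𝕜 ℬ 𝒜 n) ≤ kunneth 𝕜 𝒜 ℬ n

/-- `τ` is a graded twisting map. -/
def IsGradedTwisting (𝒜 : ℕ → Submodule 𝕜 A) (ℬ : ℕ → Submodule 𝕜 B)
    (τ : B ⊗[𝕜] A →ₗ[𝕜] A ⊗[𝕜] B) : Prop :=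
  IsTwisting 𝕜 A B τ ∧ IsGradedMapBA 𝕜 A B 𝒜 ℬ τ

/-- A graded linear map `τ` is graded twisting to degree `n`:  it satisfies the unital
conditions and the twisting identity in all (Künneth) degrees `≤ n`. -/
def TwistingToDeg (𝒜 : ℕ → Submodule 𝕜 A) (ℬ : ℕ → Submodule 𝕜 B)
    (τ : B ⊗[𝕜] A →ₗ[𝕜] A ⊗[𝕜] B) (n : ℕ) : Prop :=
  IsGradedMapBA 𝕜 A B 𝒜 ℬ τ ∧
  (∀ j ≤ n, ∀ a ∈ 𝒜 j, τ ((1 : B) ⊗ₜ[𝕜] a) = a ⊗ₜ[𝕜] (1 : B)) ∧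
  (∀ j ≤ n, ∀ b ∈ ℬ j, τ (b ⊗ₜ[𝕜] (1 : A)) = (1 : A) ⊗ₜ[𝕜] b) ∧
  (∀ j ≤ n, ∀ x ∈ kunneth 𝕜 (kunneth 𝕜 ℬ ℬ) (kunneth 𝕜 𝒜 𝒜) j,
    twistLHS 𝕜 A B τ x = twistRHS 𝕜 A B τ x)

/-- The unique extension property of a graded twisting map:  for every `n ≥ 3`, any
linear map `τ'` that is graded twisting to degree `n` and agrees with `τ` in all degrees
`< n` also agrees with `τ` in degree `n`. -/
def UEP (𝒜 : ℕ → Submodule 𝕜 A) (ℬ : ℕ → Submodule 𝕜 B)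
    (τ : B ⊗[𝕜] A →ₗ[𝕜] A ⊗[𝕜] B) : Prop :=
  ∀ n, 3 ≤ n → ∀ τ' : B ⊗[𝕜] A →ₗ[𝕜] A ⊗[𝕜] B,
    TwistingToDeg 𝕜 A B 𝒜 ℬ τ' n →
    (∀ i < n, ∀ x ∈ kunneth 𝕜 ℬ 𝒜 i, τ' x = τ x) →
    ∀ x ∈ kunneth 𝕜 ℬ 𝒜 n, τ' x = τ x

/-- The multiplication `μ_τ = (μ_A ⊗ μ_B)(1_A ⊗ τ ⊗ 1_B)` on `A ⊗ B`. -/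
def mulTau (τ : B ⊗[𝕜] A →ₗ[𝕜] A ⊗[𝕜] B) :
    (A ⊗[𝕜] B) ⊗[𝕜] (A ⊗[𝕜] B) →ₗ[𝕜] A ⊗[𝕜] B :=
  TensorProduct.map (LinearMap.mul' 𝕜 A) (LinearMap.mul' 𝕜 B)
    ∘ₗ (TensorProduct.assoc 𝕜 A A (B ⊗[𝕜] B)).symm.toLinearMap
    ∘ₗ LinearMap.lTensor A (TensorProduct.assoc 𝕜 A B B).toLinearMap
    ∘ₗ LinearMap.lTensor A (LinearMap.rTensor B τ)
    ∘ₗ LinearMap.lTensor A (TensorProduct.assoc 𝕜 B A B).symm.toLinearMap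
    ∘ₗ (TensorProduct.assoc 𝕜 A B (A ⊗[𝕜] B)).toLinearMap

/-- `(C, ψ)` realizes the twisted tensor product algebra `A ⊗_τ B`:  `ψ` is a linear
isomorphism carrying the multiplication `μ_τ` and its unit to those of `C`. -/
def Realizes (τ : B ⊗[𝕜] A →ₗ[𝕜] A ⊗[𝕜] B) (C : Type) [Ring C] [Algebra 𝕜 C]
    (ψ : A ⊗[𝕜] B →ₗ[𝕜] C) : Prop :=
  Function.Bijective ψ ∧ ψ ((1 : A) ⊗ₜ[𝕜] (1 : B)) = 1 ∧
  ∀ x y : A ⊗[𝕜] B, ψ (mulTau 𝕜 A B τ (x ⊗ₜ[𝕜] y)) = ψ x * ψ y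

/-- The two-sided ideal generated by a subset, as a `𝕜`-submodule. -/
def idealSpan (C : Type) [Ring C] [Algebra 𝕜 C] (s : Set C) : Submodule 𝕜 C :=
  Submodule.span 𝕜 {x | ∃ c d r, r ∈ s ∧ x = c * r * d}

/-- Weight grading of the tensor algebra. -/
def tensorWeight (V : Type) [AddCommGroup V] [Module 𝕜 V] (n : ℕ) :
    Submodule 𝕜 (TensorAlgebra 𝕜 V) :=
  LinearMap.range (TensorAlgebra.ι 𝕜 (M := V)) ^ n

instance (V : Type) [AddCommGroup V] [Module 𝕜 V] : GradedAlgebra (tensorWeight 𝕜 V) :=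
  inferInstanceAs (GradedAlgebra
    ((LinearMap.range (TensorAlgebra.ι 𝕜 : V →ₗ[𝕜] TensorAlgebra 𝕜 V) ^ ·) : ℕ → Submodule 𝕜 _))

/-- The canonical map `T(C₁) → C` for a graded algebra `C`. -/
def canMap (C : Type) [Ring C] [Algebra 𝕜 C] (𝒞 : ℕ → Submodule 𝕜 C) :
    TensorAlgebra 𝕜 ↥(𝒞 1) →ₐ[𝕜] C :=
  TensorAlgebra.lift 𝕜 (𝒞 1).subtype

/-- `C` (with grading `𝒞`) is a quadratic algebra: the canonical map `T(C₁) → C` is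
surjective and its kernel is generated, as a two-sided ideal, by its degree 2 part. -/
def IsQuadraticAlg (C : Type) [Ring C] [Algebra 𝕜 C] (𝒞 : ℕ → Submodule 𝕜 C) : Prop :=
  Function.Surjective (canMap 𝕜 C 𝒞) ∧
  LinearMap.ker (canMap 𝕜 C 𝒞).toLinearMap =
    idealSpan 𝕜 (TensorAlgebra 𝕜 ↥(𝒞 1))
      ((LinearMap.ker (canMap 𝕜 C 𝒞).toLinearMap ⊓ tensorWeight 𝕜 ↥(𝒞 1) 2 : Submodule 𝕜 _) : Set _)

/-- The left ideal generated by the positive part of a graded algebra. -/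
def augIdeal (C : Type) [Ring C] [Algebra 𝕜 C] (𝒞 : ℕ → Submodule 𝕜 C) : Submodule C C :=
  Submodule.span C {x : C | ∃ i, 0 < i ∧ x ∈ 𝒞 i}

/-- The degree `n` component of the graded free module on generators `σ` in degree `i`. -/
def freeGrade (C : Type) [Ring C] [Algebra 𝕜 C] (𝒞 : ℕ → Submodule 𝕜 C)
    (i : ℕ) (σ : Type) (n : ℕ) : Submodule 𝕜 (σ →₀ C) :=
  ⨅ (j : σ), Submodule.comap (Finsupp.lapply j : (σ →₀ C) →ₗ[𝕜] C)
    (if i ≤ n then 𝒞 (n - i) else ⊥)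

/-- `C` (with grading `𝒞`) is a Koszul algebra: the trivial module `𝕜 = C/C₊` admits a
resolution by graded free modules with the `i`-th term generated in degree `i`. -/
def IsKoszul (C : Type) [Ring C] [Algebra 𝕜 C] (𝒞 : ℕ → Submodule 𝕜 C) : Prop :=
  ∃ (σ : ℕ → Type) (d : ∀ i : ℕ, ((σ (i + 1)) →₀ C) →ₗ[C] ((σ i) →₀ C))
    (ε : ((σ 0) →₀ C) →ₗ[C] (C ⧸ augIdeal 𝕜 C 𝒞)),
    Function.Surjective ε ∧
    LinearMap.ker ε = LinearMap.range (d 0) ∧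
    (∀ i, LinearMap.ker (d i) = LinearMap.range (d (i + 1))) ∧
    (∀ i n, ∀ x ∈ freeGrade 𝕜 C 𝒞 (i + 1) (σ (i + 1)) n, d i x ∈ freeGrade 𝕜 C 𝒞 i (σ i) n) ∧
    (∀ n, 0 < n → ∀ x ∈ freeGrade 𝕜 C 𝒞 0 (σ 0) n, ε x = 0)

/-- `(P, ιA, ιB)` is a free product (coproduct) of `A` and `B`. -/
def IsFreeProduct (P : Type) [Ring P] [Algebra 𝕜 P] (ιA : A →ₐ[𝕜] P) (ιB : B →ₐ[𝕜] P) :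
    Prop :=
  ∀ (C : Type) [Ring C] [Algebra 𝕜 C], ∀ (f : A →ₐ[𝕜] C) (g : B →ₐ[𝕜] C),
    ∃! h : P →ₐ[𝕜] C, h.comp ιA = f ∧ h.comp ιB = g

/-- The linear map `A ⊗ B → P`, `a ⊗ b ↦ ιA(a) · ιB(b)`. -/
def mulMapP (P : Type) [Ring P] [Algebra 𝕜 P] (ιA : A →ₐ[𝕜] P) (ιB : B →ₐ[𝕜] P) :
    A ⊗[𝕜] B →ₗ[𝕜] P :=
  TensorProduct.lift (LinearMap.mk₂ 𝕜 (fun a b => ιA a * ιB b)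
    (fun a a' b => by simp [map_add, add_mul])
    (fun c a b => by simp [map_smul, smul_mul_assoc])
    (fun a b b' => by simp [map_add, mul_add])
    (fun c a b => by simp [map_smul, mul_smul_comm]))

/-- The set of `τ`-relations `b ⊗ a - τ(b ⊗ a)` of total degree at most `n`,
inside the free product `P`. -/
def relSetLe (P : Type) [Ring P] [Algebra 𝕜 P] (ιA : A →ₐ[𝕜] P) (ιB : B →ₐ[𝕜] P)
    (𝒜 : ℕ → Submodule 𝕜 A) (ℬ : ℕ → Submodule 𝕜 B)
    (τ : B ⊗[𝕜] A →ₗ[𝕜] A ⊗[𝕜] B) (n : ℕ) : Set P :=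
  {x | ∃ i j a b, i + j ≤ n ∧ a ∈ 𝒜 i ∧ b ∈ ℬ j ∧
    x = ιB b * ιA a - mulMapP 𝕜 A B P ιA ιB (τ (b ⊗ₜ[𝕜] a))}

/-- The set of all `τ`-relations `b ⊗ a - τ(b ⊗ a)` inside the free product `P`. -/
def relSetAll (P : Type) [Ring P] [Algebra 𝕜 P] (ιA : A →ₐ[𝕜] P) (ιB : B →ₐ[𝕜] P)
    (τ : B ⊗[𝕜] A →ₗ[𝕜] A ⊗[𝕜] B) : Set P :=
  {x | ∃ a b, x = ιB b * ιA a - mulMapP 𝕜 A B P ιA ιB (τ (b ⊗ₜ[𝕜] a))}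

/-- The (Künneth) grading on the free product `P` of the graded algebras `A` and `B`. -/
def freeProdGrade (P : Type) [Ring P] [Algebra 𝕜 P] (ιA : A →ₐ[𝕜] P) (ιB : B →ₐ[𝕜] P)
    (𝒜 : ℕ → Submodule 𝕜 A) (ℬ : ℕ → Submodule 𝕜 B) (n : ℕ) : Submodule 𝕜 P :=
  ⨆ (l : List ℕ) (_ : l.sum = n),
    ((l.map (fun i => Submodule.map ιA.toLinearMap (𝒜 i) ⊔ Submodule.map ιB.toLinearMap (ℬ i))).foldr
      (· * ·) 1)

end TTP

namespace TTP

section Kunneth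

variable {𝕜 : Type} [Field 𝕜] {M N : Type} [AddCommGroup M] [Module 𝕜 M]
  [AddCommGroup N] [Module 𝕜 N] {𝒜 : ℕ → Submodule 𝕜 M} {ℬ : ℕ → Submodule 𝕜 N}

theorem tmul_mem_kunneth {i j n : ℕ} (h : i + j = n) {x : M} (hx : x ∈ 𝒜 i) {y : N}
    (hy : y ∈ ℬ j) : x ⊗ₜ[𝕜] y ∈ kunneth 𝕜 𝒜 ℬ n :=
  Submodule.mem_iSup_of_mem (i, j) (Submodule.mem_iSup_of_mem h ⟨⟨x, hx⟩ ⊗ₜ ⟨y, hy⟩, by simp⟩)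

theorem kunneth_le {n : ℕ} {S : Submodule 𝕜 (M ⊗[𝕜] N)}
    (h : ∀ i j, i + j = n → ∀ x ∈ 𝒜 i, ∀ y ∈ ℬ j, x ⊗ₜ[𝕜] y ∈ S) : kunneth 𝕜 𝒜 ℬ n ≤ S := by
  refine iSup₂_le fun ij hij => ?_
  rintro _ ⟨z, rfl⟩
  induction z with
  | zero => simp
  | tmul x y => exact h _ _ hij _ x.2 _ y.2
  | add x y hx hy => rw [map_add]; exact S.add_mem hx hy

theorem eqOn_kunneth {n : ℕ} {P : Type} [AddCommGroup P] [Module 𝕜 P] {f g : M ⊗[𝕜] N →ₗ[𝕜] P}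
    (h : ∀ i j, i + j = n → ∀ x ∈ 𝒜 i, ∀ y ∈ ℬ j, f (x ⊗ₜ y) = g (x ⊗ₜ y)) {z : M ⊗[𝕜] N}
    (hz : z ∈ kunneth 𝕜 𝒜 ℬ n) : f z = g z :=
  (kunneth_le (S := LinearMap.eqLocus f g) h) hz

theorem tmul_ne_zero {x : M} {y : N} (hx : x ≠ 0) (hy : y ≠ 0) : x ⊗ₜ[𝕜] y ≠ 0 := by
  intro h
  obtain ⟨f, hf⟩ : ∃ f : Module.Dual 𝕜 M, f x ≠ 0 := by
    by_contra! hf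
    exact hx ((Module.forall_dual_apply_eq_zero_iff 𝕜 x).1 hf)
  obtain ⟨g, hg⟩ : ∃ g : Module.Dual 𝕜 N, g y ≠ 0 := by
    by_contra! hg
    exact hy ((Module.forall_dual_apply_eq_zero_iff 𝕜 y).1 hg)
  have := congrArg (LinearMap.mul' 𝕜 𝕜 ∘ₗ TensorProduct.map f g) h
  simp [hf, hg] at this

end Kunneth

section Truncation

variable {𝕜 : Type} [Field 𝕜] {A B W : Type} [Ring A] [Algebra 𝕜 A] [Ring B] [Algebra 𝕜 B]
  [AddCommGroup W] [Module 𝕜 W] (𝒜 : ℕ → Submodule 𝕜 A) (ℬ : ℕ → Submodule 𝕜 B)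
  [GradedAlgebra 𝒜] [GradedAlgebra ℬ]

theorem proj_of_mem {i : ℕ} {a : A} (ha : a ∈ 𝒜 i) (j : ℕ) :
    GradedAlgebra.proj 𝒜 j a = if i = j then a else 0 := by
  split_ifs with h
  · subst h; exact DirectSum.decompose_of_mem_same 𝒜 ha
  · exact DirectSum.decompose_of_mem_ne 𝒜 ha h

/-- The linear map that agrees with `f` in Künneth degree `n` and vanishes in all others. -/
def degreePart (f : A ⊗[𝕜] B →ₗ[𝕜] W) (n : ℕ) : A ⊗[𝕜] B →ₗ[𝕜] W :=
  ∑ k ∈ Finset.range (n + 1),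
    f ∘ₗ TensorProduct.map (GradedAlgebra.proj 𝒜 k) (GradedAlgebra.proj ℬ (n - k))

theorem degreePart_tmul (f : A ⊗[𝕜] B →ₗ[𝕜] W) (n : ℕ) {i j : ℕ} {a : A} (ha : a ∈ 𝒜 i)
    {b : B} (hb : b ∈ ℬ j) :
    degreePart 𝒜 ℬ f n (a ⊗ₜ b) = if i + j = n then f (a ⊗ₜ b) else 0 := by
  have key : ∀ k ∈ Finset.range (n + 1),
      f ((GradedAlgebra.proj 𝒜 k a) ⊗ₜ[𝕜] (GradedAlgebra.proj ℬ (n - k) b)) =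
        if i = k then (if i + j = n then f (a ⊗ₜ b) else 0) else 0 := by
    intro k hk
    rw [Finset.mem_range] at hk
    rw [proj_of_mem 𝒜 ha, proj_of_mem ℬ hb]
    by_cases h : i = k
    · subst h
      by_cases h' : i + j = n
      · simp [show j = n - i by lia, show i + (n - i) = n by lia]
      · simp [h', show j ≠ n - i by lia]
    · simp [h]
  simp only [degreePart, LinearMap.sum_apply, LinearMap.comp_apply, TensorProduct.map_tmul]
  rw [Finset.sum_congr rfl key, Finset.sum_ite_eq]
  by_cases h : i + j = n
  · simp [h, show i ≤ n by lia]
  · simp [h]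

end Truncation

section MulTau

variable {𝕜 : Type} [Field 𝕜] {A B : Type} [Ring A] [Algebra 𝕜 A] [Ring B] [Algebra 𝕜 B]
  (τ : B ⊗[𝕜] A →ₗ[𝕜] A ⊗[𝕜] B)

theorem mulTau_tmul_tmul (p z : A) (q u : B) :
    mulTau 𝕜 A B τ ((p ⊗ₜ q) ⊗ₜ (z ⊗ₜ u)) =
      TensorProduct.map (LinearMap.mulLeft 𝕜 p) (LinearMap.mulRight 𝕜 u) (τ (q ⊗ₜ z)) := by
  simp only [mulTau, LinearMap.comp_apply, LinearEquiv.coe_coe, TensorProduct.assoc_tmul,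
    LinearMap.lTensor_tmul, TensorProduct.assoc_symm_tmul, LinearMap.rTensor_tmul]
  induction τ (q ⊗ₜ z) with
  | zero => simp
  | tmul x y => simp
  | add x y hx hy => simp only [add_tmul, tmul_add, map_add, hx, hy]

theorem mulTau_add (τ g : B ⊗[𝕜] A →ₗ[𝕜] A ⊗[𝕜] B) :
    mulTau 𝕜 A B (τ + g) = mulTau 𝕜 A B τ + mulTau 𝕜 A B g := by
  ext p q z u
  simp [mulTau_tmul_tmul]

theorem twistRHS_tmul_tmul (b b' : B) (a a' : A) :
    twistRHS 𝕜 A B τ ((b ⊗ₜ b') ⊗ₜ (a ⊗ₜ a')) =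
      (mulTau 𝕜 A B τ ∘ₗ TensorProduct.map (curry τ b) ((curry τ).flip a')) (τ (b' ⊗ₜ a)) := by
  simp only [twistRHS, LinearMap.comp_apply, LinearEquiv.coe_coe, TensorProduct.assoc_tmul,
    LinearMap.lTensor_tmul, TensorProduct.assoc_symm_tmul, LinearMap.rTensor_tmul]
  induction τ (b' ⊗ₜ a) with
  | zero => simp
  | tmul x y => simp [mulTau]
  | add x y hx hy => simp only [add_tmul, tmul_add, map_add, hx, hy]

theorem mulTau_one_tmul (b : B) (z : A) (u : B) :
    mulTau 𝕜 A B τ ((1 ⊗ₜ b) ⊗ₜ (z ⊗ₜ u)) =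
      LinearMap.lTensor A (LinearMap.mulRight 𝕜 u) (τ (b ⊗ₜ z)) := by
  simp [mulTau_tmul_tmul, LinearMap.lTensor, LinearMap.mulLeft_one]

theorem mulTau_tmul_one (x a : A) (y : B) :
    mulTau 𝕜 A B τ ((x ⊗ₜ y) ⊗ₜ (a ⊗ₜ 1)) =
      LinearMap.rTensor B (LinearMap.mulLeft 𝕜 x) (τ (y ⊗ₜ a)) := by
  simp [mulTau_tmul_tmul, LinearMap.rTensor, LinearMap.mulRight_one]

theorem mulTau_tmul_tmul_eq_lTensor (t : A ⊗[𝕜] B) (z : A) (u : B) :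
    mulTau 𝕜 A B τ (t ⊗ₜ (z ⊗ₜ u)) =
      LinearMap.lTensor A (LinearMap.mulRight 𝕜 u) (mulTau 𝕜 A B τ (t ⊗ₜ (z ⊗ₜ 1))) := by
  induction t with
  | zero => simp
  | tmul p q =>
    rw [mulTau_tmul_one, mulTau_tmul_tmul]
    exact (LinearMap.congr_fun (LinearMap.lTensor_comp_rTensor ..) _).symm
  | add x y hx hy => simp only [add_tmul, map_add, hx, hy]

variable {τ} {𝒜 : ℕ → Submodule 𝕜 A} {ℬ : ℕ → Submodule 𝕜 B}

theorem IsGradedMapBA.apply_tmul_mem (hτ : IsGradedMapBA 𝕜 A B 𝒜 ℬ τ) {i j m : ℕ}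
    (h : i + j = m) {b : B} (hb : b ∈ ℬ i) {a : A} (ha : a ∈ 𝒜 j) :
    τ (b ⊗ₜ a) ∈ kunneth 𝕜 𝒜 ℬ m :=
  hτ m ⟨_, tmul_mem_kunneth h hb ha, rfl⟩

/-- A graded unital map compatible with each multiplication separately, in degrees at most `n`,
is graded twisting to degree `n`. -/
theorem twistingToDeg_of_mul_left_of_mul_right [GradedAlgebra 𝒜] [GradedAlgebra ℬ] {n : ℕ}
    (hτ : IsGradedMapBA 𝕜 A B 𝒜 ℬ τ)
    (hA : ∀ j ≤ n, ∀ a ∈ 𝒜 j, τ ((1 : B) ⊗ₜ[𝕜] a) = a ⊗ₜ[𝕜] (1 : B))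
    (hB : ∀ j ≤ n, ∀ b ∈ ℬ j, τ (b ⊗ₜ[𝕜] (1 : A)) = (1 : A) ⊗ₜ[𝕜] b)
    (hmulA : ∀ i j k, i + j + k ≤ n → ∀ b ∈ ℬ i, ∀ a ∈ 𝒜 j, ∀ a' ∈ 𝒜 k,
      τ (b ⊗ₜ (a * a')) = mulTau 𝕜 A B τ (τ (b ⊗ₜ a) ⊗ₜ (a' ⊗ₜ 1)))
    (hmulB : ∀ i j k, i + j + k ≤ n → ∀ b ∈ ℬ i, ∀ b' ∈ ℬ j, ∀ a ∈ 𝒜 k,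
      τ ((b * b') ⊗ₜ a) = mulTau 𝕜 A B τ ((1 ⊗ₜ b) ⊗ₜ τ (b' ⊗ₜ a))) :
    TwistingToDeg 𝕜 A B 𝒜 ℬ τ n := by
  refine ⟨hτ, hA, hB, fun m hm x hx => eqOn_kunneth (fun r s hrs u hu v hv => ?_) hx⟩
  refine eqOn_kunneth (f := twistLHS 𝕜 A B τ ∘ₗ (mk 𝕜 _ _).flip v)
    (g := twistRHS 𝕜 A B τ ∘ₗ (mk 𝕜 _ _).flip v) (fun i j hij b hb b' hb' => ?_) hu
  refine eqOn_kunneth (f := twistLHS 𝕜 A B τ ∘ₗ mk 𝕜 _ _ (b ⊗ₜ b'))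
    (g := twistRHS 𝕜 A B τ ∘ₗ mk 𝕜 _ _ (b ⊗ₜ b')) (fun k l hkl a ha a' ha' => ?_) hv
  simp only [LinearMap.comp_apply, mk_apply, twistRHS_tmul_tmul]
  simp only [twistLHS, LinearMap.comp_apply, TensorProduct.map_tmul, LinearMap.mul'_apply]
  rw [hmulB i j (k + l) (by lia) b hb b' hb' _ (SetLike.mul_mem_graded ha ha'),
    hmulA j k l (by lia) b' hb' a ha a' ha']
  refine eqOn_kunneth
    (f := mulTau 𝕜 A B τ ∘ₗ mk 𝕜 _ _ (1 ⊗ₜ b) ∘ₗ mulTau 𝕜 A B τ ∘ₗ (mk 𝕜 _ _).flip (a' ⊗ₜ 1))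
    (g := mulTau 𝕜 A B τ ∘ₗ TensorProduct.map (curry τ b) ((curry τ).flip a'))
    (fun p q hpq x hx y hy => ?_) (hτ.apply_tmul_mem rfl hb' ha)
  simp only [LinearMap.comp_apply, mk_apply, LinearMap.flip_apply, TensorProduct.map_tmul,
    curry_apply, mulTau_tmul_one]
  refine eqOn_kunneth
    (f := mulTau 𝕜 A B τ ∘ₗ mk 𝕜 _ _ (1 ⊗ₜ b) ∘ₗ LinearMap.rTensor B (LinearMap.mulLeft 𝕜 x))
    (g := mulTau 𝕜 A B τ ∘ₗ mk 𝕜 _ _ (τ (b ⊗ₜ x)))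
    (fun c d hcd z hz w hw => ?_) (hτ.apply_tmul_mem rfl hy ha')
  simp only [LinearMap.comp_apply, mk_apply, LinearMap.rTensor_tmul, LinearMap.mulLeft_apply]
  rw [mulTau_one_tmul, hmulA i p c (by lia) b hb x hx z hz, ← mulTau_tmul_tmul_eq_lTensor]

end MulTau

section UniqueExtension

variable {𝕜 : Type} [Field 𝕜] {A B : Type} [Ring A] [Algebra 𝕜 A] [Ring B] [Algebra 𝕜 B]
  {τ : B ⊗[𝕜] A →ₗ[𝕜] A ⊗[𝕜] B}

theorem IsTwisting.apply_tmul_mul (hτ : IsTwisting 𝕜 A B τ) (b : B) (a a' : A) :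
    τ (b ⊗ₜ (a * a')) = mulTau 𝕜 A B τ (τ (b ⊗ₜ a) ⊗ₜ (a' ⊗ₜ 1)) := by
  have h := LinearMap.congr_fun hτ.2.2 ((1 ⊗ₜ b) ⊗ₜ (a ⊗ₜ a'))
  rw [twistRHS_tmul_tmul] at h
  simp only [twistLHS, LinearMap.comp_apply, TensorProduct.map_tmul, LinearMap.mul'_apply,
    one_mul] at h
  rw [h]
  induction τ (b ⊗ₜ a) with
  | zero => simp
  | tmul x y =>
    simp only [TensorProduct.map_tmul, curry_apply, LinearMap.flip_apply, hτ.1, mulTau_tmul_one]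
    induction τ (y ⊗ₜ a') with
    | zero => simp
    | tmul z u => simp [mulTau_tmul_tmul, hτ.1]
    | add s t hs ht => simp only [tmul_add, map_add, hs, ht]
  | add s t hs ht => simp only [add_tmul, map_add, hs, ht]

theorem IsTwisting.apply_mul_tmul (hτ : IsTwisting 𝕜 A B τ) (b b' : B) (a : A) :
    τ ((b * b') ⊗ₜ a) = mulTau 𝕜 A B τ ((1 ⊗ₜ b) ⊗ₜ τ (b' ⊗ₜ a)) := by
  have h := LinearMap.congr_fun hτ.2.2 ((b ⊗ₜ b') ⊗ₜ (a ⊗ₜ 1))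
  rw [twistRHS_tmul_tmul] at h
  simp only [twistLHS, LinearMap.comp_apply, TensorProduct.map_tmul, LinearMap.mul'_apply,
    mul_one] at h
  rw [h]
  induction τ (b' ⊗ₜ a) with
  | zero => simp
  | tmul x y =>
    simp only [TensorProduct.map_tmul, curry_apply, LinearMap.flip_apply, hτ.2.1, mulTau_one_tmul]
    induction τ (b ⊗ₜ x) with
    | zero => simp
    | tmul z u => simp [mulTau_tmul_tmul, hτ.2.1]
    | add s t hs ht => simp only [add_tmul, map_add, hs, ht]
  | add s t hs ht => simp only [tmul_add, map_add, hs, ht]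

variable {P : Type} [Ring P] [Algebra 𝕜 P] {jA : A →ₐ[𝕜] P} {jB : B →ₐ[𝕜] P}

theorem mulMapP_tmul (a : A) (b : B) : mulMapP 𝕜 A B P jA jB (a ⊗ₜ b) = jA a * jB b := rfl

theorem mul_mulMapP (a : A) (t : A ⊗[𝕜] B) :
    jA a * mulMapP 𝕜 A B P jA jB t =
      mulMapP 𝕜 A B P jA jB (LinearMap.rTensor B (LinearMap.mulLeft 𝕜 a) t) := by
  induction t with
  | zero => simp
  | tmul x y => simp [mulMapP_tmul, mul_assoc]
  | add s t hs ht => simp only [mul_add, map_add, hs, ht]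

theorem mulMapP_mul (t : A ⊗[𝕜] B) (b : B) :
    mulMapP 𝕜 A B P jA jB t * jB b =
      mulMapP 𝕜 A B P jA jB (LinearMap.lTensor A (LinearMap.mulRight 𝕜 b) t) := by
  induction t with
  | zero => simp
  | tmul x y => simp [mulMapP_tmul, mul_assoc]
  | add s t hs ht => simp only [add_mul, map_add, hs, ht]

variable {𝒜 : ℕ → Submodule 𝕜 A} {ℬ : ℕ → Submodule 𝕜 B} [GradedAlgebra 𝒜] [GradedAlgebra ℬ]

/-- If a functional on `P` kills all products `jA a * jB b` and the `τ`-relations hold in `P` in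
degrees below `n`, then adding the functional, evaluated on the degree `n` products `jB b * jA a`,
to `τ` yields a map that is graded twisting to degree `n`. -/
theorem twistingToDeg_add_degreePart
    (hconnA : 𝒜 0 = (1 : Submodule 𝕜 A)) (hconnB : ℬ 0 = (1 : Submodule 𝕜 B))
    (hτ : IsGradedTwisting 𝕜 A B 𝒜 ℬ τ) {n : ℕ}
    (hrel : ∀ i j, i + j < n → ∀ b ∈ ℬ i, ∀ a ∈ 𝒜 j,
      jB b * jA a = mulMapP 𝕜 A B P jA jB (τ (b ⊗ₜ a)))
    (l : P →ₗ[𝕜] 𝕜) (hl : ∀ t, l (mulMapP 𝕜 A B P jA jB t) = 0)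
    {w : A ⊗[𝕜] B} (hw : w ∈ kunneth 𝕜 𝒜 ℬ n) :
    TwistingToDeg 𝕜 A B 𝒜 ℬ
      (τ + degreePart ℬ 𝒜 (l.smulRight w ∘ₗ mulMapP 𝕜 B A P jB jA) n) n := by
  obtain ⟨hτ, hgr⟩ := hτ
  have hg_ne : ∀ i j, i + j ≠ n → ∀ b ∈ ℬ i, ∀ a ∈ 𝒜 j,
      degreePart ℬ 𝒜 (l.smulRight w ∘ₗ mulMapP 𝕜 B A P jB jA) n (b ⊗ₜ a) = 0 :=
    fun i j h b hb a ha => by rw [degreePart_tmul ℬ 𝒜 _ n hb ha, if_neg h]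
  have hg : ∀ i j, i + j ≤ n → ∀ b ∈ ℬ i, ∀ a ∈ 𝒜 j,
      degreePart ℬ 𝒜 (l.smulRight w ∘ₗ mulMapP 𝕜 B A P jB jA) n (b ⊗ₜ a) =
        l (jB b * jA a) • w := by
    intro i j h b hb a ha
    rcases h.lt_or_eq with h | h
    · rw [hg_ne i j h.ne b hb a ha, hrel i j h b hb a ha, hl, zero_smul]
    · rw [degreePart_tmul ℬ 𝒜 _ n hb ha, if_pos h]
      rfl
  generalize degreePart ℬ 𝒜 (l.smulRight w ∘ₗ mulMapP 𝕜 B A P jB jA) n = g at hg hg_ne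
  have hg_gr : IsGradedMapBA 𝕜 A B 𝒜 ℬ g := by
    intro m
    rw [Submodule.map_le_iff_le_comap]
    refine kunneth_le fun i j hij b hb a ha => ?_
    rw [Submodule.mem_comap]
    by_cases h : i + j = n
    · rw [hg i j h.le b hb a ha, ← hij, h]
      exact Submodule.smul_mem _ _ hw
    · rw [hg_ne i j h b hb a ha]
      exact zero_mem _
  have hone_tmul : ∀ j ≤ n, ∀ a ∈ 𝒜 j, (τ + g) (1 ⊗ₜ a) = a ⊗ₜ 1 := by
    intro j hj a ha
    have : l (jA a) = 0 := by simpa [mulMapP_tmul] using hl (a ⊗ₜ 1)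
    simp [hτ.1, hg 0 j (by lia) 1 (SetLike.GradedOne.one_mem) a ha, this]
  have htmul_one : ∀ j ≤ n, ∀ b ∈ ℬ j, (τ + g) (b ⊗ₜ 1) = 1 ⊗ₜ b := by
    intro j hj b hb
    have : l (jB b) = 0 := by simpa [mulMapP_tmul] using hl (1 ⊗ₜ b)
    simp [hτ.2.1, hg j 0 (by lia) b hb 1 (SetLike.GradedOne.one_mem), this]
  have hgr' : IsGradedMapBA 𝕜 A B 𝒜 ℬ (τ + g) := by
    intro m
    rw [Submodule.map_le_iff_le_comap]
    exact fun z hz => add_mem (hgr m ⟨z, hz, rfl⟩) (hg_gr m ⟨z, hz, rfl⟩)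
  have hgL : ∀ i j k, i + j + k ≤ n → ∀ x ∈ 𝒜 i, ∀ y ∈ ℬ j, ∀ a ∈ 𝒜 k,
      mulTau 𝕜 A B g ((x ⊗ₜ y) ⊗ₜ (a ⊗ₜ 1)) = l (jA x * jB y * jA a) • w := by
    intro i j k h x hx y hy a ha
    rw [mulTau_tmul_one, mul_assoc]
    rcases Nat.eq_zero_or_pos i with rfl | hi
    · rw [hconnA] at hx
      obtain ⟨c, rfl⟩ := Submodule.mem_one.1 hx
      have : LinearMap.mulLeft 𝕜 (algebraMap 𝕜 A c) = c • LinearMap.id := by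
        ext; simp [Algebra.smul_def]
      rw [this, hg j k (by lia) y hy a ha]
      simp [← Algebra.smul_def, smul_smul, mul_comm]
    · rw [hg_ne j k (by lia) y hy a ha, hrel j k (by lia) y hy a ha, mul_mulMapP, hl]
      simp
  have hgR : ∀ i j k, i + j + k ≤ n → ∀ b ∈ ℬ i, ∀ x ∈ 𝒜 j, ∀ y ∈ ℬ k,
      mulTau 𝕜 A B g ((1 ⊗ₜ b) ⊗ₜ (x ⊗ₜ y)) = l (jB b * (jA x * jB y)) • w := by
    intro i j k h b hb x hx y hy
    rw [mulTau_one_tmul, ← mul_assoc]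
    rcases Nat.eq_zero_or_pos k with rfl | hk
    · rw [hconnB] at hy
      obtain ⟨c, rfl⟩ := Submodule.mem_one.1 hy
      have : LinearMap.mulRight 𝕜 (algebraMap 𝕜 B c) = c • LinearMap.id := by
        ext; simp [Algebra.smul_def, Algebra.commutes]
      rw [this, hg i j (by lia) b hb x hx]
      simp [← Algebra.commutes, ← Algebra.smul_def, smul_smul, mul_comm]
    · rw [hg_ne i j (by lia) b hb x hx, hrel i j (by lia) b hb x hx, mulMapP_mul, hl]
      simp
  refine twistingToDeg_of_mul_left_of_mul_right hgr' hone_tmul htmul_one ?_ ?_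
  · intro i j k h b hb a ha a' ha'
    rcases Nat.eq_zero_or_pos k with rfl | hk
    · rw [hconnA] at ha'
      obtain ⟨c, rfl⟩ := Submodule.mem_one.1 ha'
      have hz : mulTau 𝕜 A B (τ + g) ((τ + g) (b ⊗ₜ a) ⊗ₜ (1 ⊗ₜ 1)) = (τ + g) (b ⊗ₜ a) := by
        refine eqOn_kunneth (f := mulTau 𝕜 A B (τ + g) ∘ₗ (mk 𝕜 _ _).flip (1 ⊗ₜ 1))
          (g := LinearMap.id) (fun p q hpq x hx y hy => ?_) (hgr'.apply_tmul_mem rfl hb ha)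
        simp only [LinearMap.comp_apply, LinearMap.flip_apply, mk_apply, mulTau_tmul_one,
          htmul_one q (by lia) y hy]
        simp
      rw [Algebra.algebraMap_eq_smul_one, mul_smul_comm, mul_one, tmul_smul, map_smul,
        ← smul_tmul', tmul_smul, map_smul, hz]
    · have hga : (τ + g) (b ⊗ₜ a) = τ (b ⊗ₜ a) := by
        simp [hg_ne i j (by lia) b hb a ha]
      have hz := hgr.apply_tmul_mem rfl hb ha
      rw [hga, mulTau_add, LinearMap.add_apply, LinearMap.add_apply, hτ.apply_tmul_mul,
        hg i (j + k) (by lia) b hb _ (SetLike.mul_mem_graded ha ha'), map_mul jA, ← mul_assoc,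
        hrel i j (by lia) b hb a ha]
      congr 1
      exact eqOn_kunneth
        (f := l.smulRight w ∘ₗ LinearMap.mulRight 𝕜 (jA a') ∘ₗ mulMapP 𝕜 A B P jA jB)
        (g := mulTau 𝕜 A B g ∘ₗ (mk 𝕜 _ _).flip (a' ⊗ₜ 1))
        (fun p q hpq x hx y hy => (hgL p q k (by lia) x hx y hy a' ha').symm) hz
  · intro i j k h b hb b' hb' a ha
    rcases Nat.eq_zero_or_pos i with rfl | hi
    · rw [hconnB] at hb
      obtain ⟨c, rfl⟩ := Submodule.mem_one.1 hb
      have hz : mulTau 𝕜 A B (τ + g) ((1 ⊗ₜ 1) ⊗ₜ (τ + g) (b' ⊗ₜ a)) = (τ + g) (b' ⊗ₜ a) := by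
        refine eqOn_kunneth (f := mulTau 𝕜 A B (τ + g) ∘ₗ mk 𝕜 _ _ (1 ⊗ₜ 1))
          (g := LinearMap.id) (fun p q hpq x hx y hy => ?_) (hgr'.apply_tmul_mem rfl hb' ha)
        simp only [LinearMap.comp_apply, mk_apply, mulTau_one_tmul, hone_tmul p (by lia) x hx]
        simp
      rw [Algebra.algebraMap_eq_smul_one, smul_mul_assoc, one_mul, ← smul_tmul', map_smul,
        tmul_smul, ← smul_tmul', map_smul, hz]
    · have hga : (τ + g) (b' ⊗ₜ a) = τ (b' ⊗ₜ a) := by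
        simp [hg_ne j k (by lia) b' hb' a ha]
      have hz := hgr.apply_tmul_mem rfl hb' ha
      rw [hga, mulTau_add, LinearMap.add_apply, LinearMap.add_apply, hτ.apply_mul_tmul,
        hg (i + j) k (by lia) _ (SetLike.mul_mem_graded hb hb') a ha, map_mul jB, mul_assoc,
        hrel j k (by lia) b' hb' a ha]
      congr 1
      exact eqOn_kunneth
        (f := l.smulRight w ∘ₗ LinearMap.mulLeft 𝕜 (jB b) ∘ₗ mulMapP 𝕜 A B P jA jB)
        (g := mulTau 𝕜 A B g ∘ₗ mk 𝕜 _ _ (1 ⊗ₜ b))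
        (fun p q hpq x hx y hy => (hgR i p q (by lia) b hb x hx y hy).symm) hz

/-- Under the unique extension property, an algebra over which `A ⊗ B` is a retract satisfies
all `τ`-relations as soon as it satisfies those of degree at most `2`. -/
theorem UEP.mul_eq_mulMapP
    (hconnA : 𝒜 0 = (1 : Submodule 𝕜 A)) (hconnB : ℬ 0 = (1 : Submodule 𝕜 B))
    (hτ : IsGradedTwisting 𝕜 A B 𝒜 ℬ τ) (huep : UEP 𝕜 A B 𝒜 ℬ τ)
    (π : P →ₗ[𝕜] A ⊗[𝕜] B) (hπ : ∀ t, π (mulMapP 𝕜 A B P jA jB t) = t)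
    (hπτ : ∀ b a, π (jB b * jA a) = τ (b ⊗ₜ a))
    (hrel : ∀ i j, i + j ≤ 2 → ∀ b ∈ ℬ i, ∀ a ∈ 𝒜 j,
      jB b * jA a = mulMapP 𝕜 A B P jA jB (τ (b ⊗ₜ a)))
    {i j : ℕ} {b : B} (hb : b ∈ ℬ i) {a : A} (ha : a ∈ 𝒜 j) :
    jB b * jA a = mulMapP 𝕜 A B P jA jB (τ (b ⊗ₜ a)) := by
  induction hn : i + j using Nat.strong_induction_on generalizing i j b a with
  | _ n ih =>
  rcases Nat.lt_or_ge n 3 with h3 | h3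
  · exact hrel i j (by lia) b hb a ha
  by_cases hmem : jB b * jA a ∈ LinearMap.range (mulMapP 𝕜 A B P jA jB)
  · obtain ⟨t, ht⟩ := hmem
    rw [← hπτ, ← ht, hπ]
  obtain ⟨l, hne, hl⟩ := Submodule.exists_le_ker_of_notMem hmem
  have hb0 : b ≠ 0 := by rintro rfl; simp at hne
  have ha0 : a ≠ 0 := by rintro rfl; simp at hne
  have hw : a ⊗ₜ[𝕜] b ∈ kunneth 𝕜 𝒜 ℬ n := tmul_mem_kunneth (by lia) ha hb
  have hext := twistingToDeg_add_degreePart hconnA hconnB hτ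
    (fun i j h b hb a ha => ih (i + j) h hb ha rfl) l (fun t => hl ⟨t, rfl⟩) hw
  have hagree := huep n h3 _ hext (fun m hm z hz => ?_) _ (tmul_mem_kunneth hn hb ha)
  · rw [LinearMap.add_apply, degreePart_tmul ℬ 𝒜 _ n hb ha, if_pos hn, add_eq_left] at hagree
    exact absurd hagree (smul_ne_zero (M := A ⊗[𝕜] B) hne (tmul_ne_zero ha0 hb0))
  · refine eqOn_kunneth (fun p q hpq b hb a ha => ?_) hz
    rw [LinearMap.add_apply, degreePart_tmul ℬ 𝒜 _ n hb ha, if_neg (by lia), add_zero]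

end UniqueExtension

section QuadraticCover

variable {𝕜 : Type} [Field 𝕜]

theorem subset_idealSpan {C : Type} [Ring C] [Algebra 𝕜 C] (s : Set C) :
    s ⊆ idealSpan 𝕜 C s :=
  fun r hr => Submodule.subset_span ⟨1, 1, r, hr, by simp⟩

theorem idealSpan_le_ker {C D : Type} [Ring C] [Algebra 𝕜 C] [Ring D] [Algebra 𝕜 D]
    {s : Set C} {f : C →ₐ[𝕜] D} (h : ∀ r ∈ s, f r = 0) :
    idealSpan 𝕜 C s ≤ LinearMap.ker f.toLinearMap := by
  refine Submodule.span_le.2 ?_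
  rintro _ ⟨c, d, r, hr, rfl⟩
  simp [h r hr]

theorem mul_mul_mem_idealSpan {C : Type} [Ring C] [Algebra 𝕜 C] {s : Set C} (c d : C) {x : C}
    (hx : x ∈ idealSpan 𝕜 C s) : c * x * d ∈ idealSpan 𝕜 C s := by
  suffices idealSpan 𝕜 C s ≤ (idealSpan 𝕜 C s).comap
      (LinearMap.mulRight 𝕜 d ∘ₗ LinearMap.mulLeft 𝕜 c) from this hx
  refine Submodule.span_le.2 ?_
  rintro _ ⟨c', d', r, hr, rfl⟩
  exact Submodule.subset_span ⟨c * c', d' * d, r, hr, by simp [mul_assoc]⟩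

variable {A C : Type} [Ring A] [Algebra 𝕜 A] [Ring C] [Algebra 𝕜 C]
  (𝒜 : ℕ → Submodule 𝕜 A) (𝒞 : ℕ → Submodule 𝕜 C)

@[simp]
theorem canMap_ι (x : 𝒞 1) : canMap 𝕜 C 𝒞 (TensorAlgebra.ι 𝕜 x) = x := by
  simp [canMap]

/-- The ideal of the tensor algebra generated by the quadratic relations of `C`. -/
def quadIdeal : Ideal (TensorAlgebra 𝕜 ↥(𝒞 1)) where
  carrier := idealSpan 𝕜 (TensorAlgebra 𝕜 ↥(𝒞 1))
      ((LinearMap.ker (canMap 𝕜 C 𝒞).toLinearMap ⊓ tensorWeight 𝕜 ↥(𝒞 1) 2 : Submodule 𝕜 _) : Set _)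
  add_mem' := Submodule.add_mem _
  zero_mem' := Submodule.zero_mem _
  smul_mem' c x hx := by
    have := mul_mul_mem_idealSpan c 1 hx
    rwa [mul_one] at this

instance : (quadIdeal 𝒞).IsTwoSided where
  mul_mem_of_left d hx := by
    have := mul_mul_mem_idealSpan 1 d hx
    rwa [one_mul] at this

theorem canMap_eq_zero_of_mem_quadIdeal {t : TensorAlgebra 𝕜 ↥(𝒞 1)} (ht : t ∈ quadIdeal 𝒞) :
    canMap 𝕜 C 𝒞 t = 0 :=
  idealSpan_le_ker (f := canMap 𝕜 C 𝒞) (fun _ hr => hr.1) ht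

theorem isQuadraticAlg_of_ker_le (hsurj : Function.Surjective (canMap 𝕜 C 𝒞))
    (hker : ∀ t, canMap 𝕜 C 𝒞 t = 0 → t ∈ quadIdeal 𝒞) : IsQuadraticAlg 𝕜 C 𝒞 :=
  ⟨hsurj, le_antisymm (fun t ht => hker t ht) fun _ ht => canMap_eq_zero_of_mem_quadIdeal 𝒞 ht⟩

/-- The quadratic algebra with the same generators and quadratic relations as `C`. -/
abbrev QuadCover : Type := TensorAlgebra 𝕜 ↥(𝒞 1) ⧸ quadIdeal 𝒞

/-- The canonical map from the tensor algebra to the quadratic cover. -/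
abbrev quadMk : TensorAlgebra 𝕜 ↥(𝒞 1) →ₐ[𝕜] QuadCover 𝒞 :=
  Ideal.Quotient.mkₐ 𝕜 (quadIdeal 𝒞)

/-- The canonical map from the quadratic cover of `C` to `C`. -/
def quadCoverMap : QuadCover 𝒞 →ₐ[𝕜] C :=
  Ideal.Quotient.liftₐ (quadIdeal 𝒞) (canMap 𝕜 C 𝒞) fun _ => canMap_eq_zero_of_mem_quadIdeal 𝒞

@[simp]
theorem quadCoverMap_quadMk (t : TensorAlgebra 𝕜 ↥(𝒞 1)) :
    quadCoverMap 𝒞 (quadMk 𝒞 t) = canMap 𝕜 C 𝒞 t := rfl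

theorem quadMk_surjective : Function.Surjective (quadMk 𝒞) :=
  Ideal.Quotient.mkₐ_surjective 𝕜 _

theorem quadMk_eq_zero_iff {t : TensorAlgebra 𝕜 ↥(𝒞 1)} : quadMk 𝒞 t = 0 ↔ t ∈ quadIdeal 𝒞 :=
  Ideal.Quotient.eq_zero_iff_mem

theorem eq_zero_of_mem_map_tensorWeight_two {x : QuadCover 𝒞}
    (hx : x ∈ (tensorWeight 𝕜 ↥(𝒞 1) 2).map (quadMk 𝒞).toLinearMap)
    (h : quadCoverMap 𝒞 x = 0) : x = 0 := by
  obtain ⟨t, ht, rfl⟩ := hx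
  exact (quadMk_eq_zero_iff 𝒞).2 (subset_idealSpan _ ⟨h, ht⟩)

variable {𝒜}

theorem IsQuadraticAlg.exists_lift (h : IsQuadraticAlg 𝕜 A 𝒜) {P : Type} [Ring P] [Algebra 𝕜 P]
    (f : TensorAlgebra 𝕜 ↥(𝒜 1) →ₐ[𝕜] P)
    (hf : ∀ t ∈ tensorWeight 𝕜 ↥(𝒜 1) 2, canMap 𝕜 A 𝒜 t = 0 → f t = 0) :
    ∃ j : A →ₐ[𝕜] P, ∀ t, j (canMap 𝕜 A 𝒜 t) = f t := by
  have hker : ∀ t, canMap 𝕜 A 𝒜 t = 0 → f t = 0 := fun t ht =>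
    idealSpan_le_ker (f := f) (fun r hr => hf r hr.2 hr.1) (h.2.le ht)
  let g : A →+* P := RingHom.liftOfSurjective (canMap 𝕜 A 𝒜).toRingHom h.1 ⟨f.toRingHom, hker⟩
  have hg : ∀ t, g (canMap 𝕜 A 𝒜 t) = f t := fun t =>
    RingHom.liftOfRightInverse_comp_apply _ _ (Function.rightInverse_surjInv h.1)
      ⟨f.toRingHom, hker⟩ t
  refine ⟨{ g with commutes' := fun c => ?_ }, hg⟩
  simpa using hg (algebraMap 𝕜 _ c)

theorem canMap_mem [GradedAlgebra 𝒜] {n : ℕ} {t : TensorAlgebra 𝕜 ↥(𝒜 1)}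
    (ht : t ∈ tensorWeight 𝕜 ↥(𝒜 1) n) : canMap 𝕜 A 𝒜 t ∈ 𝒜 n := by
  induction ht using Submodule.pow_induction_on_left' with
  | algebraMap r => simpa using SetLike.algebraMap_mem_graded 𝒜 r
  | add x y i hx hy h h' => rw [map_add]; exact add_mem h h'
  | mem_mul m hm i x hx h =>
    obtain ⟨v, rfl⟩ := hm
    rw [map_mul, canMap_ι, Nat.succ_eq_one_add]
    exact SetLike.mul_mem_graded v.2 h

theorem exists_mem_tensorWeight [GradedAlgebra 𝒜] (h : Function.Surjective (canMap 𝕜 A 𝒜)) {n : ℕ}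
    {a : A} (ha : a ∈ 𝒜 n) : ∃ t ∈ tensorWeight 𝕜 ↥(𝒜 1) n, canMap 𝕜 A 𝒜 t = a := by
  obtain ⟨t, rfl⟩ := h a
  have key : ∀ s, canMap 𝕜 A 𝒜 (GradedAlgebra.proj (tensorWeight 𝕜 ↥(𝒜 1)) n s) =
      GradedAlgebra.proj 𝒜 n (canMap 𝕜 A 𝒜 s) := by
    intro s
    induction s using DirectSum.Decomposition.inductionOn (tensorWeight 𝕜 ↥(𝒜 1)) with
    | zero => simp
    | homogeneous s =>
      rw [proj_of_mem _ s.2, proj_of_mem 𝒜 (canMap_mem s.2)]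
      split_ifs <;> simp
    | add s s' hs hs' => simp only [map_add, hs, hs']
  refine ⟨_, SetLike.coe_mem (DirectSum.decompose (tensorWeight 𝕜 ↥(𝒜 1)) t n), (key t).trans ?_⟩
  rw [proj_of_mem 𝒜 ha, if_pos rfl]

/-- A homomorphism from a quadratic algebra that preserves degree `1` lifts to the quadratic
cover. -/
theorem IsQuadraticAlg.exists_lift_quadCover [GradedAlgebra 𝒜] (h : IsQuadraticAlg 𝕜 A 𝒜)
    (f : A →ₐ[𝕜] C) (hf : ∀ a ∈ 𝒜 1, f a ∈ 𝒞 1) :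
    ∃ j : A →ₐ[𝕜] QuadCover 𝒞,
      (∀ a, quadCoverMap 𝒞 (j a) = f a) ∧
      (∀ a (ha : a ∈ 𝒜 1), j a = quadMk 𝒞 (TensorAlgebra.ι 𝕜 ⟨f a, hf a ha⟩)) ∧
      ∀ n, ∀ a ∈ 𝒜 n, j a ∈ (tensorWeight 𝕜 ↥(𝒞 1) n).map (quadMk 𝒞).toLinearMap := by
  let e : 𝒜 1 →ₗ[𝕜] 𝒞 1 := f.toLinearMap.restrict hf
  let θ : TensorAlgebra 𝕜 ↥(𝒜 1) →ₐ[𝕜] TensorAlgebra 𝕜 ↥(𝒞 1) :=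
    TensorAlgebra.lift 𝕜 (TensorAlgebra.ι 𝕜 ∘ₗ e)
  have hθι : ∀ x, θ (TensorAlgebra.ι 𝕜 x) = TensorAlgebra.ι 𝕜 (e x) := fun x => by simp [θ]
  have hθ : ∀ t, canMap 𝕜 C 𝒞 (θ t) = f (canMap 𝕜 A 𝒜 t) := by
    refine fun t => DFunLike.congr_fun
      (f := (canMap 𝕜 C 𝒞).comp θ) (g := f.comp (canMap 𝕜 A 𝒜)) ?_ t
    ext x
    simp [hθι]
    rfl
  have hθw : ∀ n, ∀ t ∈ tensorWeight 𝕜 ↥(𝒜 1) n, θ t ∈ tensorWeight 𝕜 ↥(𝒞 1) n := by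
    intro n t ht
    have : (tensorWeight 𝕜 ↥(𝒜 1) n).map θ.toLinearMap ≤ tensorWeight 𝕜 ↥(𝒞 1) n := by
      rw [tensorWeight, Submodule.map_pow]
      refine pow_le_pow_left' ?_ n
      rintro _ ⟨_, ⟨x, rfl⟩, rfl⟩
      exact ⟨e x, (hθι x).symm⟩
    exact this ⟨t, ht, rfl⟩
  obtain ⟨j, hj⟩ := h.exists_lift ((quadMk 𝒞).comp θ) fun t ht ht0 =>
    eq_zero_of_mem_map_tensorWeight_two 𝒞 ⟨θ t, hθw 2 t ht, rfl⟩ 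
      ((hθ t).trans (by rw [ht0, map_zero]))
  refine ⟨j, fun a => ?_, fun a ha => ?_, fun n a ha => ?_⟩
  · obtain ⟨t, rfl⟩ := h.1 a
    rw [hj, AlgHom.comp_apply, quadCoverMap_quadMk, hθ]
  · have := hj (TensorAlgebra.ι 𝕜 ⟨a, ha⟩)
    rwa [canMap_ι, AlgHom.comp_apply, hθι] at this
  · obtain ⟨t, ht, rfl⟩ := exists_mem_tensorWeight h.1 ha
    exact ⟨θ t, hθw n t ht, (hj t).symm⟩

end QuadraticCover

section Realization

variable {𝕜 : Type} [Field 𝕜] {A B : Type} [Ring A] [Algebra 𝕜 A] [Ring B] [Algebra 𝕜 B]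
  {τ : B ⊗[𝕜] A →ₗ[𝕜] A ⊗[𝕜] B} {C : Type} [Ring C] [Algebra 𝕜 C] {ψ : A ⊗[𝕜] B →ₗ[𝕜] C}

theorem Realizes.exists_inclusions (hψ : Realizes 𝕜 A B τ C ψ) (hτ : IsTwisting 𝕜 A B τ) :
    ∃ (α : A →ₐ[𝕜] C) (β : B →ₐ[𝕜] C), (∀ a, α a = ψ (a ⊗ₜ 1)) ∧ (∀ b, β b = ψ (1 ⊗ₜ b)) ∧
      (∀ t, mulMapP 𝕜 A B C α β t = ψ t) ∧ ∀ b a, β b * α a = ψ (τ (b ⊗ₜ a)) := by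
  obtain ⟨-, hone, hmul⟩ := hψ
  let α : A →ₐ[𝕜] C := AlgHom.ofLinearMap (ψ ∘ₗ (mk 𝕜 A B).flip 1) hone fun a a' => by
    simp [← hmul, mulTau_tmul_one, hτ.1]
  let β : B →ₐ[𝕜] C := AlgHom.ofLinearMap (ψ ∘ₗ mk 𝕜 A B 1) hone fun b b' => by
    simp [← hmul, mulTau_one_tmul, hτ.2.1]
  have hα : ∀ a, α a = ψ (a ⊗ₜ 1) := fun _ => rfl
  have hβ : ∀ b, β b = ψ (1 ⊗ₜ b) := fun _ => rfl
  refine ⟨α, β, hα, hβ, fun t => ?_, fun b a => ?_⟩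
  · refine LinearMap.congr_fun (TensorProduct.ext' fun a b => ?_) t
    rw [mulMapP_tmul, hα, hβ, ← hmul, mulTau_tmul_tmul, hτ.1]
    simp
  · rw [hα, hβ, ← hmul, mulTau_one_tmul]
    simp [LinearMap.mulRight_one]

theorem map_mulMapP {P : Type} [Ring P] [Algebra 𝕜 P] (jA : A →ₐ[𝕜] P) (jB : B →ₐ[𝕜] P)
    (π : P →ₐ[𝕜] C) (t : A ⊗[𝕜] B) :
    π (mulMapP 𝕜 A B P jA jB t) = mulMapP 𝕜 A B C (π.comp jA) (π.comp jB) t :=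
  LinearMap.congr_fun (f := π.toLinearMap ∘ₗ mulMapP 𝕜 A B P jA jB)
    (TensorProduct.ext' fun a b => by simp [mulMapP_tmul]) t

theorem exists_eq_tmul_one_add_one_tmul {𝒜 : ℕ → Submodule 𝕜 A} {ℬ : ℕ → Submodule 𝕜 B}
    (hconnA : 𝒜 0 = (1 : Submodule 𝕜 A)) (hconnB : ℬ 0 = (1 : Submodule 𝕜 B)) {z : A ⊗[𝕜] B}
    (hz : z ∈ kunneth 𝕜 𝒜 ℬ 1) : ∃ a ∈ 𝒜 1, ∃ b ∈ ℬ 1, z = a ⊗ₜ 1 + 1 ⊗ₜ b := by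
  have hle : kunneth 𝕜 𝒜 ℬ 1 ≤ (𝒜 1).map ((mk 𝕜 A B).flip 1) ⊔ (ℬ 1).map (mk 𝕜 A B 1) := by
    refine kunneth_le fun i j hij a ha b hb => ?_
    obtain ⟨rfl, rfl⟩ | ⟨rfl, rfl⟩ : (i = 0 ∧ j = 1) ∨ (i = 1 ∧ j = 0) := by lia
    · rw [hconnA] at ha
      obtain ⟨c, rfl⟩ := Submodule.mem_one.1 ha
      refine Submodule.mem_sup_right ⟨c • b, Submodule.smul_mem _ _ hb, ?_⟩
      simp [Algebra.algebraMap_eq_smul_one, ← smul_tmul']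
    · rw [hconnB] at hb
      obtain ⟨c, rfl⟩ := Submodule.mem_one.1 hb
      refine Submodule.mem_sup_left ⟨c • a, Submodule.smul_mem _ _ ha, ?_⟩
      simp [Algebra.algebraMap_eq_smul_one]
  obtain ⟨_, ⟨a, ha, rfl⟩, _, ⟨b, hb, rfl⟩, rfl⟩ := Submodule.mem_sup.1 (hle hz)
  exact ⟨a, ha, b, hb, rfl⟩

/-- If all `τ`-relations hold in `P`, the image of `A ⊗ B` is stable under left multiplication
by `B`. -/
theorem mul_mem_range_mulMapP {P : Type} [Ring P] [Algebra 𝕜 P] {jA : A →ₐ[𝕜] P} {jB : B →ₐ[𝕜] P}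
    (hrel : ∀ b a, jB b * jA a = mulMapP 𝕜 A B P jA jB (τ (b ⊗ₜ a))) (b : B) (t : A ⊗[𝕜] B) :
    jB b * mulMapP 𝕜 A B P jA jB t ∈ LinearMap.range (mulMapP 𝕜 A B P jA jB) := by
  induction t with
  | zero => simp
  | tmul x y => exact ⟨LinearMap.lTensor A (LinearMap.mulRight 𝕜 y) (τ (b ⊗ₜ x)), by
      rw [mulMapP_tmul, ← mul_assoc, hrel, mulMapP_mul]⟩
  | add s t hs ht => rw [map_add, mul_add]; exact add_mem hs ht

end Realization

section Generation

variable {𝕜 : Type} [Field 𝕜] {A B : Type} [Ring A] [Algebra 𝕜 A] [Ring B] [Algebra 𝕜 B]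
  {τ : B ⊗[𝕜] A →ₗ[𝕜] A ⊗[𝕜] B} {P : Type} [Ring P] [Algebra 𝕜 P] {jA : A →ₐ[𝕜] P}
  {jB : B →ₐ[𝕜] P}

/-- If all `τ`-relations hold in `P`, then `A ⊗ B` maps onto the subalgebra generated by elements
of the form `jA a + jB b`. -/
theorem mem_range_mulMapP_of_tensorAlgebra
    (hrel : ∀ b a, jB b * jA a = mulMapP 𝕜 A B P jA jB (τ (b ⊗ₜ a)))
    {V : Type} [AddCommGroup V] [Module 𝕜 V] (q : TensorAlgebra 𝕜 V →ₐ[𝕜] P)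
    (hq : ∀ v, ∃ a b, q (TensorAlgebra.ι 𝕜 v) = jA a + jB b) (t : TensorAlgebra 𝕜 V) :
    q t ∈ LinearMap.range (mulMapP 𝕜 A B P jA jB) := by
  suffices ∀ x ∈ LinearMap.range (mulMapP 𝕜 A B P jA jB),
      q t * x ∈ LinearMap.range (mulMapP 𝕜 A B P jA jB) by
    simpa using this 1 ⟨1 ⊗ₜ 1, by rw [mulMapP_tmul, map_one, map_one, mul_one]⟩
  induction t using TensorAlgebra.induction with
  | algebraMap c =>
    intro x hx
    rw [AlgHom.commutes, ← Algebra.smul_def]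
    exact Submodule.smul_mem _ _ hx
  | ι v =>
    rintro _ ⟨s, rfl⟩
    obtain ⟨a, b, hv⟩ := hq v
    rw [hv, add_mul, mul_mulMapP]
    exact add_mem ⟨_, rfl⟩ (mul_mem_range_mulMapP hrel b s)
  | mul s t hs ht =>
    intro x hx
    rw [map_mul, mul_assoc]
    exact hs _ (ht x hx)
  | add s t hs ht =>
    intro x hx
    rw [map_add, add_mul]
    exact add_mem (hs x hx) (ht x hx)

variable {𝒜 : ℕ → Submodule 𝕜 A} {ℬ : ℕ → Submodule 𝕜 B}

theorem mulMapP_mem_of_mem_kunneth {𝒟 : ℕ → Submodule 𝕜 P}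
    (h𝒟 : ∀ i j, ∀ x ∈ 𝒟 i, ∀ y ∈ 𝒟 j, x * y ∈ 𝒟 (i + j))
    (hA : ∀ i, ∀ a ∈ 𝒜 i, jA a ∈ 𝒟 i) (hB : ∀ i, ∀ b ∈ ℬ i, jB b ∈ 𝒟 i) {n : ℕ}
    {z : A ⊗[𝕜] B} (hz : z ∈ kunneth 𝕜 𝒜 ℬ n) : mulMapP 𝕜 A B P jA jB z ∈ 𝒟 n := by
  suffices kunneth 𝕜 𝒜 ℬ n ≤ (𝒟 n).comap (mulMapP 𝕜 A B P jA jB) from this hz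
  refine kunneth_le fun i j hij a ha b hb => ?_
  exact hij ▸ h𝒟 i j _ (hA i a ha) _ (hB j b hb)

/-- Under the unique extension property, the `τ`-relations hold in any algebra `P` over
`A ⊗_τ B` whose projection is injective in degree `2`. -/
theorem UEP.mul_eq_mulMapP_of_injOn_two [GradedAlgebra 𝒜] [GradedAlgebra ℬ]
    (huep : UEP 𝕜 A B 𝒜 ℬ τ)
    (hconnA : 𝒜 0 = (1 : Submodule 𝕜 A)) (hconnB : ℬ 0 = (1 : Submodule 𝕜 B))
    (hτ : IsGradedTwisting 𝕜 A B 𝒜 ℬ τ) (π : P →ₗ[𝕜] A ⊗[𝕜] B)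
    (hπ : ∀ t, π (mulMapP 𝕜 A B P jA jB t) = t) (hπτ : ∀ b a, π (jB b * jA a) = τ (b ⊗ₜ a))
    {𝒟 : ℕ → Submodule 𝕜 P} (h𝒟 : ∀ i j, ∀ x ∈ 𝒟 i, ∀ y ∈ 𝒟 j, x * y ∈ 𝒟 (i + j))
    (hA : ∀ i, ∀ a ∈ 𝒜 i, jA a ∈ 𝒟 i) (hB : ∀ i, ∀ b ∈ ℬ i, jB b ∈ 𝒟 i)
    (hinj : ∀ x ∈ 𝒟 2, π x = 0 → x = 0) (b : B) (a : A) :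
    jB b * jA a = mulMapP 𝕜 A B P jA jB (τ (b ⊗ₜ a)) := by
  have hrel2 : ∀ i j, i + j ≤ 2 → ∀ b ∈ ℬ i, ∀ a ∈ 𝒜 j,
      jB b * jA a = mulMapP 𝕜 A B P jA jB (τ (b ⊗ₜ a)) := by
    intro i j hij b hb a ha
    rcases Nat.eq_zero_or_pos i with rfl | hi
    · rw [hconnB] at hb
      obtain ⟨c, rfl⟩ := Submodule.mem_one.1 hb
      rw [Algebra.algebraMap_eq_smul_one, ← smul_tmul', map_smul τ, hτ.1.1]
      simp [mulMapP_tmul]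
    rcases Nat.eq_zero_or_pos j with rfl | hj
    · rw [hconnA] at ha
      obtain ⟨c, rfl⟩ := Submodule.mem_one.1 ha
      rw [Algebra.algebraMap_eq_smul_one, tmul_smul, map_smul τ, hτ.1.2.1]
      simp [mulMapP_tmul]
    obtain ⟨rfl, rfl⟩ : i = 1 ∧ j = 1 := by lia
    refine sub_eq_zero.1 (hinj _ (sub_mem (h𝒟 1 1 _ (hB 1 b hb) _ (hA 1 a ha))
      (mulMapP_mem_of_mem_kunneth h𝒟 hA hB (hτ.2.apply_tmul_mem one_add_one_eq_two hb ha))) ?_)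
    rw [map_sub, hπ, hπτ, sub_self]
  induction b using DirectSum.Decomposition.inductionOn ℬ with
  | zero => simp
  | add b b' h h' => simp only [map_add, add_mul, add_tmul, h, h']
  | homogeneous b =>
    induction a using DirectSum.Decomposition.inductionOn 𝒜 with
    | zero => simp
    | add a a' h h' => simp only [map_add, mul_add, tmul_add, h, h']
    | homogeneous a => exact huep.mul_eq_mulMapP hconnA hconnB hτ π hπ hπτ hrel2 b.2 a.2

end Generation

/-- An algebra `C` satisfying the `τ`-relations, to which `A ⊗ B` maps bijectively, is quadratic as
soon as its degree `1` part is the sum of those of `A` and `B`. -/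
theorem isQuadraticAlg_of_generators {𝕜 : Type} [Field 𝕜] {A B : Type} [Ring A] [Algebra 𝕜 A]
    [Ring B] [Algebra 𝕜 B] {𝒜 : ℕ → Submodule 𝕜 A} {ℬ : ℕ → Submodule 𝕜 B}
    [GradedAlgebra 𝒜] [GradedAlgebra ℬ]
    (hconnA : 𝒜 0 = (1 : Submodule 𝕜 A)) (hconnB : ℬ 0 = (1 : Submodule 𝕜 B))
    (hquadA : IsQuadraticAlg 𝕜 A 𝒜) (hquadB : IsQuadraticAlg 𝕜 B ℬ)
    {τ : B ⊗[𝕜] A →ₗ[𝕜] A ⊗[𝕜] B} (hτ : IsGradedTwisting 𝕜 A B 𝒜 ℬ τ) (huep : UEP 𝕜 A B 𝒜 ℬ τ)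
    {C : Type} [Ring C] [Algebra 𝕜 C] {ψ : A ⊗[𝕜] B →ₗ[𝕜] C} (hψ : Function.Bijective ψ)
    {α : A →ₐ[𝕜] C} {β : B →ₐ[𝕜] C} (hαβ : ∀ t, mulMapP 𝕜 A B C α β t = ψ t)
    (hβα : ∀ b a, β b * α a = ψ (τ (b ⊗ₜ a)))
    {𝒞 : ℕ → Submodule 𝕜 C} {hα1 : ∀ a ∈ 𝒜 1, α a ∈ 𝒞 1} {hβ1 : ∀ b ∈ ℬ 1, β b ∈ 𝒞 1}
    (h𝒞 : ∀ v : 𝒞 1, ∃ a, ∃ ha : a ∈ 𝒜 1, ∃ b, ∃ hb : b ∈ ℬ 1,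
      v = ⟨α a, hα1 a ha⟩ + ⟨β b, hβ1 b hb⟩) :
    IsQuadraticAlg 𝕜 C 𝒞 := by
  obtain ⟨jA, hπA, hjA, hjAw⟩ := hquadA.exists_lift_quadCover 𝒞 α hα1
  obtain ⟨jB, hπB, hjB, hjBw⟩ := hquadB.exists_lift_quadCover 𝒞 β hβ1
  have hπ : ∀ t, quadCoverMap 𝒞 (mulMapP 𝕜 A B (QuadCover 𝒞) jA jB t) = ψ t := by
    intro t
    have hA : (quadCoverMap 𝒞).comp jA = α := AlgHom.ext hπA
    have hB : (quadCoverMap 𝒞).comp jB = β := AlgHom.ext hπB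
    rw [map_mulMapP, hA, hB, hαβ]
  have hπτ : ∀ b a, quadCoverMap 𝒞 (jB b * jA a) = ψ (τ (b ⊗ₜ a)) := fun b a => by
    rw [map_mul, hπA, hπB, hβα]
  let e : A ⊗[𝕜] B ≃ₗ[𝕜] C := LinearEquiv.ofBijective ψ hψ
  have he : ∀ t, e.symm (ψ t) = t := e.symm_apply_apply
  have hrel : ∀ b a, jB b * jA a = mulMapP 𝕜 A B (QuadCover 𝒞) jA jB (τ (b ⊗ₜ a)) := by
    refine huep.mul_eq_mulMapP_of_injOn_two hconnA hconnB hτ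
      (e.symm.toLinearMap ∘ₗ (quadCoverMap 𝒞).toLinearMap)
      (fun t => (congrArg e.symm (hπ t)).trans (he t))
      (fun b a => (congrArg e.symm (hπτ b a)).trans (he _))
      (𝒟 := fun n => (tensorWeight 𝕜 ↥(𝒞 1) n).map (quadMk 𝒞).toLinearMap) ?_ hjAw hjBw ?_
    · rintro i j _ ⟨s, hs, rfl⟩ _ ⟨t, ht, rfl⟩
      exact ⟨s * t, SetLike.mul_mem_graded hs ht, map_mul (quadMk 𝒞) s t⟩
    · exact fun x hx hx0 => eq_zero_of_mem_map_tensorWeight_two 𝒞 hx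
        ((LinearEquiv.map_eq_zero_iff e.symm).1 hx0)
  have hgen : ∀ t, quadMk 𝒞 t ∈ LinearMap.range (mulMapP 𝕜 A B (QuadCover 𝒞) jA jB) := by
    refine mem_range_mulMapP_of_tensorAlgebra hrel (quadMk 𝒞) fun v => ?_
    obtain ⟨a, ha, b, hb, rfl⟩ := h𝒞 v
    exact ⟨a, b, by rw [hjA a ha, hjB b hb, map_add, map_add]⟩
  refine isQuadraticAlg_of_ker_le 𝒞 (fun c => ?_) fun t ht => ?_
  · obtain ⟨z, rfl⟩ := hψ.2 c
    obtain ⟨t, ht⟩ := quadMk_surjective 𝒞 (mulMapP 𝕜 A B (QuadCover 𝒞) jA jB z)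
    exact ⟨t, by rw [← quadCoverMap_quadMk, ht, hπ]⟩
  · obtain ⟨z, hz⟩ := hgen t
    have hz0 : z = 0 := hψ.1 (by rw [← hπ, hz, quadCoverMap_quadMk, ht, map_zero])
    rw [← quadMk_eq_zero_iff, ← hz, hz0, map_zero]

/-- Corollary 4.4 (`quadTTP`).  If `τ : B ⊗ A → A ⊗ B` is a graded twisting map with the
unique extension property and `A`, `B` are quadratic, then the twisted tensor product
`A ⊗_τ B` is a quadratic algebra.  (The twisted tensor product is encoded through an
arbitrary realization `(C, ψ)` of `(A ⊗ B, μ_τ)` as an algebra, with the transported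
Künneth grading.) -/
theorem stmt7 (𝕜 : Type) [Field 𝕜] (A B : Type) [Ring A] [Algebra 𝕜 A] [Ring B] [Algebra 𝕜 B]
    (𝒜 : ℕ → Submodule 𝕜 A) (ℬ : ℕ → Submodule 𝕜 B)
    [GradedAlgebra 𝒜] [GradedAlgebra ℬ]
    (hconnA : 𝒜 0 = (1 : Submodule 𝕜 A)) (hconnB : ℬ 0 = (1 : Submodule 𝕜 B))
    (hquadA : IsQuadraticAlg 𝕜 A 𝒜) (hquadB : IsQuadraticAlg 𝕜 B ℬ)
    (τ : B ⊗[𝕜] A →ₗ[𝕜] A ⊗[𝕜] B)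
    (hτ : IsGradedTwisting 𝕜 A B 𝒜 ℬ τ)
    (huep : UEP 𝕜 A B 𝒜 ℬ τ) :
    ∀ (C : Type) [Ring C] [Algebra 𝕜 C], ∀ ψ : A ⊗[𝕜] B →ₗ[𝕜] C,
      Realizes 𝕜 A B τ C ψ →
      IsQuadraticAlg 𝕜 C (fun n => Submodule.map ψ (kunneth 𝕜 𝒜 ℬ n)) := by
  intro C _ _ ψ hψ
  obtain ⟨α, β, hα, hβ, hαβ, hβα⟩ := hψ.exists_inclusions hτ.1
  generalize h𝒞 : (fun n => Submodule.map ψ (kunneth 𝕜 𝒜 ℬ n)) = 𝒞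
  have hα1 : ∀ a ∈ 𝒜 1, α a ∈ 𝒞 1 := fun a ha => h𝒞 ▸
    ⟨_, tmul_mem_kunneth (add_zero 1) ha SetLike.GradedOne.one_mem, (hα a).symm⟩
  have hβ1 : ∀ b ∈ ℬ 1, β b ∈ 𝒞 1 := fun b hb => h𝒞 ▸
    ⟨_, tmul_mem_kunneth (zero_add 1) SetLike.GradedOne.one_mem hb, (hβ b).symm⟩
  have h𝒞1 : ∀ v : 𝒞 1, ∃ a, ∃ ha : a ∈ 𝒜 1, ∃ b, ∃ hb : b ∈ ℬ 1,
      v = ⟨α a, hα1 a ha⟩ + ⟨β b, hβ1 b hb⟩ := by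
    rintro ⟨v, hv⟩
    obtain ⟨z, hz, hzv⟩ : v ∈ Submodule.map ψ (kunneth 𝕜 𝒜 ℬ 1) := by rwa [← h𝒞] at hv
    obtain ⟨a, ha, b, hb, rfl⟩ := exists_eq_tmul_one_add_one_tmul hconnA hconnB hz
    exact ⟨a, ha, b, hb, Subtype.ext (hzv.symm.trans (by rw [map_add, ← hα, ← hβ]; rfl))⟩
  exact isQuadraticAlg_of_generators hconnA hconnB hquadA hquadB hτ huep hψ.1 hαβ hβα h𝒞1

end TTP
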